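/- Let V be a finite type, let C be a finite set of pairwise constraints on V that admits at least one consistent labeling, and let x, y ∈ V with x ≠ y. If there is no walk from x to y in C of weight 0 and no walk from x to y in C of weight 1 (in particular, this covers the case where no walk from x to y exists at all), then there exist labelings ℓ₁, ℓ₂ : V → ℕ, both consistent with C, such that ℓ₁ x = ℓ₁ y and ℓ₂ x ≠ ℓ₂ y. (Completeness of the deduction rule: when Theorem 1 returns 'None', the constraint between x and y is genuinely undetermined by C and a user query is required.) -/

import Mathlib

/-- A pairwise constraint is a triple `(x, y, θ)`; `θ = false` is a must-link,
`θ = true` is a cannot-link. A labeling `ℓ` satisfies it accordingly. -/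
def Satisfies {V : Type*} (ℓ : V → ℕ) (c : V × V × Bool) : Prop :=
  if c.2.2 = true then ℓ c.1 ≠ ℓ c.2.1 else ℓ c.1 = ℓ c.2.1

/-- `ℓ` is consistent with the constraint graph `C`. -/
def Consistent {V : Type*} (ℓ : V → ℕ) (C : Finset (V × V × Bool)) : Prop :=
  ∀ c ∈ C, Satisfies ℓ c

/-- `p 0 = x, …, p m = y` is a walk from `x` to `y` in `C`, where the `i`-th step
traverses a constraint of type `θ i` present in `C` in either direction. -/
def IsWalk {V : Type*} (C : Finset (V × V × Bool)) (x y : V) (m : ℕ)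
    (p : ℕ → V) (θ : ℕ → Bool) : Prop :=
  p 0 = x ∧ p m = y ∧ ∀ i < m, (p i, p (i + 1), θ i) ∈ C ∨ (p (i + 1), p i, θ i) ∈ C

/-- The weight of a walk: the number of cannot-link constraints traversed. -/
def walkWeight (m : ℕ) (θ : ℕ → Bool) : ℕ :=
  ∑ i ∈ Finset.range m, if θ i then 1 else 0

/-- There is a walk from `x` to `y` in `C` of weight `n`. -/
def HasWalkOfWeight {V : Type*} (C : Finset (V × V × Bool)) (n : ℕ) (x y : V) : Prop :=
  ∃ m p θ, IsWalk C x y m p θ ∧ walkWeight m θ = n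

theorem HasWalkOfWeight.refl {V : Type*} (C : Finset (V × V × Bool)) (x : V) :
    HasWalkOfWeight C 0 x x :=
  ⟨0, fun _ => x, fun _ => false, ⟨rfl, rfl, by simp⟩, by simp [walkWeight]⟩

theorem HasWalkOfWeight.concat {V : Type*} {C : Finset (V × V × Bool)} {n : ℕ} {x y z : V}
    {b : Bool} (h : HasWalkOfWeight C n x y) (hyz : (y, z, b) ∈ C ∨ (z, y, b) ∈ C) :
    HasWalkOfWeight C (n + if b then 1 else 0) x z := by
  obtain ⟨m, p, θ, ⟨hp0, hpm, hstep⟩, hw⟩ := h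
  refine ⟨m + 1, fun i => if i ≤ m then p i else z, fun i => if i < m then θ i else b,
    ⟨by simpa using hp0, by simp, fun i hi => ?_⟩, ?_⟩
  · rcases Nat.lt_succ_iff_lt_or_eq.mp hi with hlt | rfl
    · simpa [hlt, hlt.le, Nat.succ_le_of_lt hlt] using hstep i hlt
    · simpa [hpm] using hyz
  · rw [walkWeight, Finset.sum_range_succ, ← hw, walkWeight]
    congr 1
    · refine Finset.sum_congr rfl fun i hi => ?_
      rw [if_pos (Finset.mem_range.mp hi)]
    · simp

/-- The equivalence relation generated by the must-link constraints of `C`. -/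
def mustLinkSetoid {V : Type*} (C : Finset (V × V × Bool)) : Setoid V :=
  Relation.EqvGen.setoid fun a b => (a, b, false) ∈ C

theorem hasWalkOfWeight_congr_right {V : Type*} {C : Finset (V × V × Bool)} {n : ℕ} {x y z : V}
    (h : mustLinkSetoid C y z) : HasWalkOfWeight C n x y ↔ HasWalkOfWeight C n x z := by
  induction h with
  | rel a b hab =>
    exact ⟨fun hw => by simpa using hw.concat (Or.inl hab),
      fun hw => by simpa using hw.concat (Or.inr hab)⟩
  | refl a => exact Iff.rfl
  | symm a b _ ih => exact ih.symm
  | trans a b c _ _ ih₁ ih₂ => exact ih₁.trans ih₂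

theorem Consistent.eq_of_mustLinkSetoid {V : Type*} {C : Finset (V × V × Bool)} {ℓ : V → ℕ}
    (hℓ : Consistent ℓ C) {a b : V} (h : mustLinkSetoid C a b) : ℓ a = ℓ b := by
  induction h with
  | rel a b hab => simpa [Satisfies] using hℓ _ hab
  | refl a => rfl
  | symm a b _ ih => exact ih.symm
  | trans a b c _ _ ih₁ ih₂ => exact ih₁.trans ih₂

/-- On a finite type, some labeling has exactly the must-link classes as its clusters. -/
theorem exists_labeling_eq_iff_mustLinkSetoid {V : Type*} [Finite V]
    (C : Finset (V × V × Bool)) : ∃ f : V → ℕ, ∀ a b, f a = f b ↔ mustLinkSetoid C a b := by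
  obtain ⟨e, he⟩ := exists_injective_nat (Quotient (mustLinkSetoid C))
  exact ⟨fun v => e (Quotient.mk _ v), fun a b => he.eq_iff.trans Quotient.eq⟩

theorem consistent_iff {V : Type*} {C : Finset (V × V × Bool)} {ℓ : V → ℕ} :
    Consistent ℓ C ↔
      (∀ a b, (a, b, false) ∈ C → ℓ a = ℓ b) ∧ ∀ a b, (a, b, true) ∈ C → ℓ a ≠ ℓ b := by
  simp only [Consistent, Satisfies, Prod.forall, Bool.forall_bool]
  simp [forall_and]

/-- Completeness of the deduction rule: if there is neither a walk of weight 0 nor a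
walk of weight 1 between `x` and `y`, the relation between them is undetermined. -/
theorem deduction_none_undetermined {V : Type*} [Fintype V]
    (C : Finset (V × V × Bool)) (x y : V) (hxy : x ≠ y)
    (hsat : ∃ ℓ : V → ℕ, Consistent ℓ C)
    (h0 : ¬ ∃ m p θ, IsWalk C x y m p θ ∧ walkWeight m θ = 0)
    (h1 : ¬ ∃ m p θ, IsWalk C x y m p θ ∧ walkWeight m θ = 1) :
    (∃ ℓ₁ : V → ℕ, Consistent ℓ₁ C ∧ ℓ₁ x = ℓ₁ y) ∧
    (∃ ℓ₂ : V → ℕ, Consistent ℓ₂ C ∧ ℓ₂ x ≠ ℓ₂ y) := by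
  obtain ⟨f, hf⟩ := exists_labeling_eq_iff_mustLinkSetoid C
  obtain ⟨ℓ, hℓ⟩ := hsat
  have hML : ∀ a b, (a, b, false) ∈ C → f a = f b := fun a b h =>
    (hf a b).2 (Relation.EqvGen.rel a b h)
  have hCL : ∀ a b, (a, b, true) ∈ C → f a ≠ f b := fun a b h hab =>
    (consistent_iff.1 hℓ).2 a b h (hℓ.eq_of_mustLinkSetoid ((hf a b).1 hab))
  have hne : f x ≠ f y := fun h =>
    h0 ((hasWalkOfWeight_congr_right ((hf x y).1 h)).1 (HasWalkOfWeight.refl C x))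
  have hsep : ∀ a b, (a, b, true) ∈ C ∨ (b, a, true) ∈ C → f a = f x → f b ≠ f y := by
    intro a b h ha hb
    have hxa : HasWalkOfWeight C 0 x a :=
      (hasWalkOfWeight_congr_right ((hf x a).1 ha.symm)).1 (HasWalkOfWeight.refl C x)
    have hxb : HasWalkOfWeight C 1 x b := by simpa using hxa.concat h
    exact h1 ((hasWalkOfWeight_congr_right ((hf b y).1 hb)).1 hxb)
  refine ⟨⟨fun v => if f v = f y then f x else f v, consistent_iff.2 ⟨fun a b h => ?_,
    fun a b h => ?_⟩, by simp⟩, f, consistent_iff.2 ⟨hML, hCL⟩, hne⟩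
  · simp only [hML a b h]
  · have hab := hCL a b h
    have h₁ := hsep a b (Or.inl h)
    have h₂ := hsep b a (Or.inr h)
    grind
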